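/- Let n and x be positive integers. Then det( δ_{ij} + C(2x+1+i+j, i) )_{0≤i,j≤2n-1} = [ n! · (x-1)! / (2n)! ] · ∏_{i=0}^{n} [ (x+2i)_{i+1} / (x+n+i)! ] · ∏_{i=0}^{n-1} [ (i!)² · ((2x+2i+2)_{i+1})² · (x+i)! · (x+2i+1)_i / ((2i)!)² ]. -/

import Mathlib

open Finset

/-- Binomial coefficient `C(m,k)` for `m : ℕ` and `k : ℤ`, zero if `k < 0` or `k > m`. -/
def C (m : ℕ) (k : ℤ) : ℚ := if 0 ≤ k then (m.choose k.toNat : ℚ) else 0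

/-- The shifted factorial (ascending Pochhammer): `(a)_k = a(a+1)⋯(a+k-1)`, as a rational. -/
def asc (a k : ℕ) : ℚ := ∏ m ∈ Finset.range k, ((a : ℚ) + m)

/-- The reciprocal factorial on `ℤ`, zero at negative arguments. -/
def invFact (k : ℤ) : ℚ := if 0 ≤ k then 1 / (k.toNat.factorial : ℚ) else 0

lemma invFact_natCast (k : ℕ) : invFact k = 1 / (k.factorial : ℚ) := by
  simp [invFact]

lemma invFact_of_neg {k : ℤ} (hk : k < 0) : invFact k = 0 := by
  simp [invFact, hk]

lemma invFact_eq (k : ℤ) : invFact k = (k + 1) * invFact (k + 1) := by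
  rcases lt_or_ge k 0 with hk | hk
  · rw [invFact_of_neg hk]
    rcases (Int.add_one_le_iff.mpr hk).lt_or_eq with h | h
    · rw [invFact_of_neg h, mul_zero]
    · have : (k : ℚ) + 1 = 0 := by exact_mod_cast h
      rw [this, zero_mul]
  · lift k to ℕ using hk
    have h : ((k : ℤ) + 1) = ((k + 1 : ℕ) : ℤ) := by push_cast; ring
    rw [h, invFact_natCast, invFact_natCast, Nat.factorial_succ]
    have := k.factorial_ne_zero
    push_cast
    field_simp

/-- The number `C(w+1+i+j, 2i+1-j) / (w+1+i+j)`, written with factorials. -/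
def ent (w i j : ℕ) : ℚ :=
  ((w + i + j).factorial : ℚ) * invFact (2 * i + 1 - j) * invFact (w - i + 2 * j)

lemma ent_succ_col (w i j : ℕ) :
    ent w i (j + 1) * ((w - i + 2 * j + 1) * (w - i + 2 * j + 2)) =
      ent w i j * ((w + 1 + i + j) * (2 * i + 1 - j)) := by
  have h1 := invFact_eq (2 * i - j)
  have h2 := invFact_eq (w - i + 2 * j)
  have h3 := invFact_eq (w - i + 2 * j + 1)
  have e1 : (2 * i + 1 - (j + 1 : ℕ) : ℤ) = 2 * i - j := by push_cast; ring
  have e2 : (w - i + 2 * (j + 1 : ℕ) : ℤ) = w - i + 2 * j + 1 + 1 := by push_cast; ring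
  have e3 : (2 * i + 1 - j : ℤ) = 2 * i - j + 1 := by ring
  unfold ent
  rw [e1, e2, e3, h1, h2, h3, ← add_assoc, Nat.factorial_succ]
  push_cast
  ring

lemma ent_succ_row (w i j : ℕ) :
    ent w (i + 1) j * ((2 * i + 3 - j) * (2 * i + 2 - j)) =
      ent w i j * ((w + 1 + i + j) * (w - i + 2 * j)) := by
  have h1 := invFact_eq (2 * i + 1 - j)
  have h2 := invFact_eq (2 * i + 1 - j + 1)
  have h3 := invFact_eq (w - i + 2 * j - 1)
  have e1 : (2 * (i + 1 : ℕ) + 1 - j : ℤ) = 2 * i + 1 - j + 1 + 1 := by push_cast; ring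
  have e2 : (w - (i + 1 : ℕ) + 2 * j : ℤ) = w - i + 2 * j - 1 := by push_cast; ring
  unfold ent
  rw [e1, e2, h1, h2, h3, sub_add_cancel, show w + (i + 1) + j = w + i + j + 1 by ring,
    Nat.factorial_succ]
  push_cast
  ring

lemma ent_succ_succ (w i j : ℕ) :
    ent w (i + 1) (j + 1) * ((2 * i + 2 - j) * (w - i + 2 * j + 1)) =
      ent w i j * ((w + 1 + i + j) * (w + 2 + i + j)) := by
  have h1 := invFact_eq (2 * i + 1 - j)
  have h2 := invFact_eq (w - i + 2 * j)
  have e1 : (2 * (i + 1 : ℕ) + 1 - (j + 1 : ℕ) : ℤ) = 2 * i + 1 - j + 1 := by push_cast; ring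
  have e2 : (w - (i + 1 : ℕ) + 2 * (j + 1 : ℕ) : ℤ) = w - i + 2 * j + 1 := by push_cast; ring
  unfold ent
  rw [e1, e2, h1, h2, show w + (i + 1) + (j + 1) = w + i + j + 1 + 1 by ring,
    Nat.factorial_succ, Nat.factorial_succ]
  push_cast
  ring

/-- Coefficients of the upper triangular matrix which triangularizes `ent w`. -/
def triCoeff (w n : ℕ) : ℕ → ℚ
  | 0 => 1
  | j + 1 => triCoeff w n j * (-4 * (j - n) * (j + w + 1 / 2) * (j + w + 1 + n) /
      ((j + 1) * (j - 2 * n) * (j + 2 * w + 2 + 2 * n)))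

lemma triCoeff_eq_zero (w : ℕ) {n j : ℕ} (h : n < j) : triCoeff w n j = 0 := by
  induction j, h using Nat.le_induction with
  | base => simp [triCoeff]
  | succ j _ ih => simp [triCoeff, ih]

lemma triCoeff_succ_succ (w n j : ℕ) (h : j ≤ n) :
    triCoeff w (n + 1) (j + 1) = triCoeff w n j *
      (4 * (j + w + 1 / 2) * (w + 1 + n + j) * (w + 2 + n + j) * (j - 1 - 2 * n) *
        (2 * w + 2 * n + 3) / ((j + 1) * (2 * n + 1) * (2 * w + 2 + 2 * n + j) *
        (2 * w + 3 + 2 * n + j) * (2 * w + 4 + 2 * n + j))) := by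
  induction j with
  | zero =>
    simp only [triCoeff]
    push_cast
    have h1 : (0 - 2 * ((n : ℚ) + 1)) ≠ 0 := by
      have : (0 : ℚ) ≤ n := n.cast_nonneg
      linarith
    field_simp
    ring
  | succ j ih =>
    rw [triCoeff, ih (by omega), triCoeff.eq_2 w n j]
    have hj : (j : ℚ) + 1 ≤ n := by exact_mod_cast h
    have hj0 : (0 : ℚ) ≤ j := j.cast_nonneg
    have h1 : ((j : ℚ) - 2 * n) ≠ 0 := by linarith
    have h2 : ((j : ℚ) + 1 - 2 * (n + 1)) ≠ 0 := by linarith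
    push_cast
    field_simp
    ring

lemma triCoeff_self_ne_zero (w n : ℕ) : triCoeff w n n ≠ 0 := by
  induction n with
  | zero => simp [triCoeff]
  | succ n ih =>
    rw [triCoeff_succ_succ w n n le_rfl]
    have hn : (0 : ℚ) ≤ n := n.cast_nonneg
    have h1 : ((n : ℚ) - 1 - 2 * n) ≠ 0 := by linarith
    refine mul_ne_zero ih (div_ne_zero ?_ (by positivity))
    refine mul_ne_zero (mul_ne_zero ?_ h1) ?_ <;> positivity

/-- Entries of the triangularized matrix. -/
def triSum (w n i : ℕ) : ℚ :=
  ∑ j ∈ range (n + 1), (2 * w + 1 + 3 * j) * triCoeff w n j * ent w i j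

lemma triSum_eq_sum_range (w i : ℕ) {n N : ℕ} (h : n < N) :
    triSum w n i = ∑ j ∈ range N, (2 * w + 1 + 3 * j) * triCoeff w n j * ent w i j := by
  refine sum_subset (range_mono h) fun j _ hj => ?_
  rw [triCoeff_eq_zero w (by simpa using hj)]
  ring

lemma triSum_succ_left (w n i : ℕ) :
    (2 * n + 1) * (i + w + n + 2) * (i - w - 1 - 2 * n) * (i - w - 2 - 2 * n) *
        triSum w (n + 1) i +
      (2 * w + 2 * n + 3) * (i - n) * (i + w + 2 * n + 2) * (i + w + 2 * n + 3) *
        triSum w n i = 0 := by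
  rw [triSum_eq_sum_range w i (show n < n + 1 + 1 by omega), triSum, mul_sum, mul_sum,
    ← sum_add_distrib]
  have key : ∀ m ≤ n + 1, ∑ j ∈ range (m + 1),
      ((2 * n + 1) * (i + w + n + 2) * (i - w - 1 - 2 * n) * (i - w - 2 - 2 * n) *
          ((2 * w + 1 + 3 * j) * triCoeff w (n + 1) j * ent w i j) +
        (2 * w + 2 * n + 3) * (i - n) * (i + w + 2 * n + 2) * (i + w + 2 * n + 3) *
          ((2 * w + 1 + 3 * j) * triCoeff w n j * ent w i j)) =
      4 * (2 * w + 2 * n + 3) * (2 * n + w + 2) * (m + w + 1 / 2) * (m + w + 1 + n) *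
        (m + 2 + w + i) / ((m + 2 * w + 2 + 2 * n) * (m + 2 * w + 2 * n + 3)) *
        triCoeff w n m * (ent w i m * ((w + 1 + i + m) * (2 * i + 1 - m))) := by
    intro m hm
    induction m with
    | zero =>
      simp only [zero_add, sum_range_one, triCoeff]
      push_cast
      field_simp
      ring
    | succ m ih =>
      rw [sum_range_succ, ih (by omega), ← ent_succ_col, triCoeff_succ_succ w n m (by omega)]
      have hm0 : (0 : ℚ) ≤ m := m.cast_nonneg
      rcases Nat.eq_zero_or_pos n with rfl | hn
      · obtain rfl : m = 0 := by omega
        rw [triCoeff_eq_zero w (show 0 < 0 + 1 by omega)]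
        simp only [triCoeff]
        push_cast
        field_simp
        ring
      · have hm' : (m : ℚ) ≤ n := by exact_mod_cast (by omega : m ≤ n)
        have hn' : (0 : ℚ) < n := by exact_mod_cast hn
        have h1 : ((m : ℚ) - 2 * n) ≠ 0 := by linarith
        have d : ((m : ℚ) + 1) * (m - 2 * n) * (m + 2 * w + 2 + 2 * n) * ((2 * n + 1) *
            (m + 2 * w + 2 * n + 3) * (m + 2 * w + 2 * n + 4)) ≠ 0 :=
          mul_ne_zero (mul_ne_zero (mul_ne_zero (by positivity) h1) (by positivity))
            (by positivity)
        obtain ⟨c, hc⟩ : ∃ c, triCoeff w n m = c * (((m : ℚ) + 1) * (m - 2 * n) *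
            (m + 2 * w + 2 + 2 * n) * ((2 * n + 1) * (m + 2 * w + 2 * n + 3) *
            (m + 2 * w + 2 * n + 4))) := ⟨_, (div_mul_cancel₀ _ d).symm⟩
        obtain ⟨a, ha⟩ : ∃ a, a = 4 * c * (m + w + 1 / 2) * (m + w + 1 + n) := ⟨_, rfl⟩
        have hc1 : triCoeff w n (m + 1) = a * (-(m - n) * ((2 * n + 1) *
            (m + 2 * w + 2 * n + 3) * (m + 2 * w + 2 * n + 4))) := by
          rw [triCoeff, hc, ha]
          field_simp
        have hc2 : triCoeff w n m * (4 * (m + w + 1 / 2) * (w + 1 + n + m) * (w + 2 + n + m) *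
            (m - 1 - 2 * n) * (2 * w + 2 * n + 3) / ((m + 1) * (2 * n + 1) *
            (2 * w + 2 + 2 * n + m) * (2 * w + 3 + 2 * n + m) * (2 * w + 4 + 2 * n + m))) =
            a * ((w + 2 + n + m) * (m - 1 - 2 * n) * (2 * w + 2 * n + 3) * (m - 2 * n)) := by
          rw [hc, mul_div_assoc', div_eq_iff (by positivity), ha]
          ring
        have hH1 : 4 * (2 * w + 2 * n + 3) * (2 * n + w + 2) * (m + w + 1 / 2) *
            (m + w + 1 + n) * (m + 2 + w + i) /
            ((m + 2 * w + 2 + 2 * n) * (m + 2 * w + 2 * n + 3)) * triCoeff w n m =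
            a * ((2 * w + 2 * n + 3) * (2 * n + w + 2) * (m + 2 + w + i) *
            ((m + 1) * (m - 2 * n) * (2 * n + 1) * (m + 2 * w + 2 * n + 4))) := by
          rw [hc, ha]
          field_simp
        have hH2 : 4 * (2 * w + 2 * n + 3) * (2 * n + w + 2) * ((m + 1 : ℕ) + w + 1 / 2) *
            ((m + 1 : ℕ) + w + 1 + n) * ((m + 1 : ℕ) + 2 + w + i) /
            (((m + 1 : ℕ) + 2 * w + 2 + 2 * n) * ((m + 1 : ℕ) + 2 * w + 2 * n + 3)) *
            triCoeff w n (m + 1) =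
            a * ((2 * w + 2 * n + 3) * (2 * n + w + 2) * (4 * m + 4 * w + 6) *
            (m + w + 2 + n) * (m + 3 + w + i) * (-(m - n) * (2 * n + 1))) := by
          have e1 : ((m + 1 : ℕ) + 2 * w + 2 + 2 * n : ℚ) = m + 2 * w + 2 * n + 3 := by
            push_cast; ring
          have e2 : ((m + 1 : ℕ) + 2 * w + 2 * n + 3 : ℚ) = m + 2 * w + 2 * n + 4 := by
            push_cast; ring
          rw [hc1, e1, e2]
          push_cast
          field_simp
          ring
        rw [hH1, hH2, hc1, hc2]
        generalize ent w i (m + 1) = e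
        push_cast
        generalize (2 * w + 2 * n + 3 : ℚ) = p
        generalize (2 * n + 1 : ℚ) = z
        ring
  rw [key (n + 1) le_rfl, triCoeff_eq_zero w (show n < n + 1 by omega)]
  ring

lemma triSum_succ_right (w n i : ℕ) (hi : n ≤ i) :
    2 * (2 * i + 3) * (i - n + 1) * (i + w + n + 2) * triSum w n (i + 1) +
      (i + w + 1) * (i - w - 2 * n) * (i + w + 2 * n + 2) * triSum w n i = 0 := by
  rw [triSum, triSum, mul_sum, mul_sum, ← sum_add_distrib]
  have key : ∀ m ≤ n, ∑ j ∈ range (m + 1),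
      (2 * (2 * i + 3) * (i - n + 1) * (i + w + n + 2) *
          ((2 * w + 1 + 3 * j) * triCoeff w n j * ent w (i + 1) j) +
        (i + w + 1) * (i - w - 2 * n) * (i + w + 2 * n + 2) *
          ((2 * w + 1 + 3 * j) * triCoeff w n j * ent w i j)) =
      4 * (3 * i + w + 4) * (m - n) * (m + w + 1 / 2) * (m + w + 1 + n) / (w + i + m + 2) *
        triCoeff w n m * (ent w (i + 1) (m + 1) * (w - i + 2 * m + 1)) := by
    intro m hm
    have hi' : (n : ℚ) ≤ i := by exact_mod_cast hi
    have hn0 : (0 : ℚ) ≤ n := n.cast_nonneg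
    have hi0 : (0 : ℚ) ≤ i := i.cast_nonneg
    induction m with
    | zero =>
      have h1 : ent w (i + 1) 0 =
          ent w i 0 * ((w + 1 + i) * (w - i)) / ((2 * i + 3) * (2 * i + 2)) := by
        have := ent_succ_row w i 0
        push_cast at this
        field_simp
        linear_combination this
      have h2 : ent w (i + 1) (0 + 1) * (w - i + 2 * (0 : ℕ) + 1) =
          ent w i 0 * ((w + 1 + i) * (w + 2 + i)) / (2 * i + 2) := by
        have := ent_succ_succ w i 0
        push_cast at this ⊢
        field_simp
        linear_combination this
      rw [h2]
      simp only [zero_add, sum_range_one, triCoeff, h1]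
      push_cast
      field_simp
      ring
    | succ m ih =>
      have hm' : (m : ℚ) + 1 ≤ n := by exact_mod_cast hm
      have hm0 : (0 : ℚ) ≤ m := m.cast_nonneg
      have d1 : (2 * i + 2 - m : ℚ) ≠ 0 := by linarith
      have d2 : (2 * i + 1 - m : ℚ) ≠ 0 := by linarith
      have d3 : ((m : ℚ) - 2 * n) ≠ 0 := by linarith
      have d4 : ((m : ℚ) + 1) * (m - 2 * n) * (m + 2 * w + 2 + 2 * n) ≠ 0 :=
        mul_ne_zero (mul_ne_zero (by positivity) d3) (by positivity)
      have h1 := ent_succ_row w i (m + 1)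
      have h2 := ent_succ_succ w i (m + 1)
      obtain ⟨e, he⟩ : ∃ e, ent w i (m + 1) = e * ((2 * i + 2 - m) * (2 * i + 1 - m)) :=
        ⟨_, (div_mul_cancel₀ _ (mul_ne_zero d1 d2)).symm⟩
      obtain ⟨c, hc⟩ : ∃ c, triCoeff w n m =
          c * ((m + 1) * (m - 2 * n) * (m + 2 * w + 2 + 2 * n)) :=
        ⟨_, (div_mul_cancel₀ _ d4).symm⟩
      have hc' : triCoeff w n (m + 1) = c * (-4 * (m - n) * (m + w + 1 / 2) * (m + w + 1 + n)) := by
        rw [triCoeff, hc, mul_assoc, mul_div_cancel₀ _ d4]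
      have h1' : ent w (i + 1) (m + 1) = e * ((w + 2 + i + m) * (w - i + 2 * m + 2)) := by
        rw [he] at h1
        push_cast at h1
        refine mul_right_cancel₀ (mul_ne_zero d1 d2) ?_
        linear_combination h1
      have h2' : ent w (i + 1) (m + 1 + 1) * (w - i + 2 * (m + 1 : ℕ) + 1) =
          e * (2 * i + 2 - m) * ((w + 2 + i + m) * (w + 3 + i + m)) := by
        rw [he] at h2
        push_cast at h2 ⊢
        refine mul_right_cancel₀ d2 ?_
        linear_combination h2
      rw [sum_range_succ, ih (by omega), h2', h1', he, hc', hc]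
      push_cast
      field_simp
      ring
  rw [key n le_rfl]
  ring

lemma triSum_eq_zero (w : ℕ) {n i : ℕ} (h : i < n) : triSum w n i = 0 := by
  induction n, h using Nat.le_induction with
  | base =>
    have h0 := triSum_succ_left w i i
    have hi : (0 : ℚ) ≤ i := i.cast_nonneg
    have hw : (0 : ℚ) ≤ w := w.cast_nonneg
    rw [sub_self, mul_zero, zero_mul, zero_mul, zero_mul, add_zero] at h0
    refine (mul_eq_zero.mp h0).resolve_left ?_
    refine mul_ne_zero (mul_ne_zero (by positivity) ?_) ?_ <;> linarith
  | succ n hn ih =>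
    have h0 := triSum_succ_left w n i
    have hi : (0 : ℚ) ≤ i := i.cast_nonneg
    have hin : (i : ℚ) + 1 ≤ n := by exact_mod_cast hn
    have hw : (0 : ℚ) ≤ w := w.cast_nonneg
    rw [ih, mul_zero, add_zero] at h0
    refine (mul_eq_zero.mp h0).resolve_left ?_
    refine mul_ne_zero (mul_ne_zero (by positivity) ?_) ?_ <;> linarith

/-- The pivots of `ent w`. -/
def pivot (w n : ℕ) : ℚ :=
  ∏ k ∈ range n, ((w + 3 * k + 2) * (w + 3 * k + 3) * (w + 3 * k + 4) * (2 * w + 1 + 3 * k) *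
    (2 * w + 2 + 3 * k) * (2 * w + 3 + 3 * k) / (4 * (2 * k + 3) * (w + 2 * k + 2) ^ 2 *
    (w + 2 * k + 3) * (2 * w + 2 * k + 1) * (w + 2 * k + 1)) : ℚ)

lemma triSum_self {w : ℕ} (hw : 0 < w) (n : ℕ) :
    triSum w n n = (2 * w + 1 + 3 * n) * triCoeff w n n * pivot w n := by
  induction n with
  | zero =>
    have h1 := invFact_eq 0
    have h2 := invFact_natCast 0
    have h3 := invFact_natCast w
    have := w.factorial_ne_zero
    simp at h1 h2
    simp [triSum, triCoeff, pivot, ent, h3, ← h1, h2]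
    field_simp
  | succ n ih =>
    have h1 := triSum_succ_left w n (n + 1)
    have h2 := triSum_succ_right w n n le_rfl
    have hn : (0 : ℚ) ≤ n := n.cast_nonneg
    rw [triCoeff_succ_succ w n n le_rfl, pivot, prod_range_succ, ← pivot]
    have hw' : (1 : ℚ) ≤ w := by exact_mod_cast hw
    have d1 : (n + 1 - w - 1 - 2 * n : ℚ) ≠ 0 := by linarith
    have d2 : (n + 1 - w - 2 - 2 * n : ℚ) ≠ 0 := by linarith
    have e2 : triSum w n (n + 1) = (w + n) * (n + w + 1) * (3 * n + w + 2) /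
        (2 * (2 * n + 3) * (2 * n + w + 2)) * triSum w n n := by
      field_simp
      linear_combination h2
    rw [e2, ih] at h1
    push_cast at h1 ⊢
    have e1 : triSum w (n + 1) (n + 1) =
        -((2 * w + 2 * n + 3) * (n + 1 - n) * (n + 1 + w + 2 * n + 2) *
            (n + 1 + w + 2 * n + 3)) *
          ((w + n) * (n + w + 1) * (3 * n + w + 2) / (2 * (2 * n + 3) * (2 * n + w + 2)) *
            ((2 * w + 1 + 3 * n) * triCoeff w n n * pivot w n)) /
          ((2 * n + 1) * (n + 1 + w + n + 2) * (n + 1 - w - 1 - 2 * n) *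
            (n + 1 - w - 2 - 2 * n)) := by
      rw [eq_div_iff (by positivity)]
      linear_combination h1
    rw [e1]
    have d3 : (n - w - 2 * n : ℚ) ≠ 0 := by linarith
    field_simp
    ring

lemma det_ent {w : ℕ} (hw : 0 < w) (N : ℕ) :
    Matrix.det (Matrix.of fun i j : Fin N => ent w i j) = ∏ n ∈ range N, pivot w n := by
  let U : Matrix (Fin N) (Fin N) ℚ := Matrix.of fun j n => (2 * w + 1 + 3 * j) * triCoeff w n j
  let T : Matrix (Fin N) (Fin N) ℚ := Matrix.of fun i n => triSum w n i
  have hU : U.det = ∏ n : Fin N, ((2 * w + 1 + 3 * (n : ℕ)) * triCoeff w n n : ℚ) := by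
    refine Matrix.det_of_isUpperTriangular fun i j hij => ?_
    change (2 * w + 1 + 3 * (i : ℕ)) * triCoeff w j i = (0 : ℚ)
    rw [triCoeff_eq_zero w (show (j : ℕ) < i from hij), mul_zero]
  have hT : T.det = ∏ n : Fin N, triSum w n n :=
    Matrix.det_of_isLowerTriangular _ fun i j hij => triSum_eq_zero w hij
  have hmul : (Matrix.of fun i j : Fin N => ent w i j) * U = T := by
    ext i n
    rw [Matrix.mul_apply]
    simp only [U, T, Matrix.of_apply]
    rw [triSum_eq_sum_range w i n.is_lt, sum_range]
    exact sum_congr rfl fun j _ => mul_comm _ _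
  have hU0 : U.det ≠ 0 := by
    rw [hU]
    exact prod_ne_zero_iff.mpr fun n _ =>
      mul_ne_zero (by positivity) (triCoeff_self_ne_zero w n)
  have h := congrArg Matrix.det hmul
  rw [Matrix.det_mul, hT] at h
  refine mul_right_cancel₀ hU0 ?_
  rw [h, hU, prod_range, ← prod_mul_distrib]
  refine prod_congr rfl fun n _ => ?_
  rw [triSum_self hw, mul_comm]

lemma eq_sum_smul_of_recurrence {R : Type*} [CommRing R] [Algebra ℚ R] (F : ℕ → ℕ → R)
    (e : ℕ → ℕ → ℕ → ℚ) (V Y : R)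
    (hF : ∀ a, F (a + 2) 0 = (Y + 2) * F (a + 1) 0 - F a 0)
    (hF' : ∀ a j, F a (j + 1) = F (a + 1) j - F a j)
    (he0 : ∀ a, e (a + 2) 0 0 = 2 * e (a + 1) 0 0 - e a 0 0)
    (he : ∀ a i, e (a + 2) 0 (i + 1) =
      e (a + 1) 0 i + 2 * e (a + 1) 0 (i + 1) - e a 0 (i + 1))
    (he' : ∀ a j i, e a (j + 1) i = e (a + 1) j i - e a j i)
    (h0 : ∀ K, F 0 0 = ∑ i ∈ range (K + 2), e 0 0 i • (V * Y ^ i))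
    (h1 : ∀ K, F 1 0 = ∑ i ∈ range (K + 3), e 1 0 i • (V * Y ^ i)) :
    ∀ j a K, a + 1 + j < K → F a j = ∑ i ∈ range K, e a j i • (V * Y ^ i) := by
  intro j
  induction j with
  | zero =>
    intro a
    induction a using Nat.twoStepInduction with
    | zero =>
      intro K hK
      obtain ⟨K, rfl⟩ := Nat.exists_eq_add_of_le' (show 2 ≤ K by omega)
      exact h0 K
    | one =>
      intro K hK
      obtain ⟨K, rfl⟩ := Nat.exists_eq_add_of_le' (show 3 ≤ K by omega)
      exact h1 K
    | more a ih ih' =>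
      intro K hK
      obtain ⟨K, rfl⟩ := Nat.exists_eq_add_of_le' (show 1 ≤ K by omega)
      have hY : Y * F (a + 1) 0 = ∑ i ∈ range K, e (a + 1) 0 i • (V * Y ^ (i + 1)) := by
        rw [ih' K (by omega), mul_sum]
        refine sum_congr rfl fun i _ => ?_
        rw [mul_smul_comm, pow_succ]
        congr 1
        ring
      rw [hF, add_mul, hY, ih (K + 1) (by omega), ih' (K + 1) (by omega), sum_range_succ',
        sum_range_succ', sum_range_succ', he0]
      simp only [he, add_smul, sub_smul, sum_add_distrib, sum_sub_distrib, two_mul]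
      ring
  | succ j ih =>
    intro a K hK
    rw [hF', ih (a + 1) K (by omega), ih a K (by omega), ← sum_sub_distrib]
    exact sum_congr rfl fun i _ => by rw [he', sub_smul]

/-- Coefficients in the expansion of `s ^ (a + 1) * (s - 1) ^ j` symmetrized under `s ↦ s⁻¹`, in
powers of `s + s⁻¹ - 2`. -/
def symCoeff (a j i : ℕ) : ℚ :=
  (2 * a + 2 + j) * (a + i).factorial * invFact (2 * i - j) * invFact (a + 1 - i + j)

/-- Coefficients in the expansion of `s ^ (a + 1) * (s - 1) ^ j` antisymmetrized under `s ↦ s⁻¹`,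
in powers of `s + s⁻¹ - 2` times `s - s⁻¹`. -/
def antiCoeff (a j i : ℕ) : ℚ :=
  (a + 1 + i).factorial * invFact (2 * i + 1 - j) * invFact (a - i + j)

lemma symCoeff_succ (a j i : ℕ) :
    symCoeff a (j + 1) i = symCoeff (a + 1) j i - symCoeff a j i := by
  have h1 := invFact_eq (2 * i - j - 1)
  have h2 := invFact_eq (a + 1 - i + j)
  unfold symCoeff
  rw [show (2 * i - (j + 1 : ℕ) : ℤ) = 2 * i - j - 1 by push_cast; ring,
    show (a + 1 - i + (j + 1 : ℕ) : ℤ) = a + 1 - i + j + 1 by push_cast; ring,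
    show ((a + 1 : ℕ) + 1 - i + j : ℤ) = a + 1 - i + j + 1 by push_cast; ring, h1, h2,
    show a + 1 + i = a + i + 1 by ring, Nat.factorial_succ, sub_add_cancel]
  push_cast
  ring

lemma antiCoeff_succ (a j i : ℕ) :
    antiCoeff a (j + 1) i = antiCoeff (a + 1) j i - antiCoeff a j i := by
  have h1 := invFact_eq (2 * i - j)
  have h2 := invFact_eq (a - i + j)
  unfold antiCoeff
  rw [show (2 * i + 1 - (j + 1 : ℕ) : ℤ) = 2 * i - j by push_cast; ring,
    show (a - i + (j + 1 : ℕ) : ℤ) = a - i + j + 1 by push_cast; ring,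
    show ((a + 1 : ℕ) - i + j : ℤ) = a - i + j + 1 by push_cast; ring, h1, h2,
    show (2 * i + 1 - j : ℤ) = 2 * i - j + 1 by ring,
    show a + 1 + 1 + i = a + 1 + i + 1 by ring, Nat.factorial_succ]
  push_cast
  ring

lemma symCoeff_add_two (a i : ℕ) : symCoeff (a + 2) 0 (i + 1) =
    symCoeff (a + 1) 0 i + 2 * symCoeff (a + 1) 0 (i + 1) - symCoeff a 0 (i + 1) := by
  have h1 := invFact_eq (2 * i)
  have h2 := invFact_eq (2 * i + 1)
  have h3 := invFact_eq (a - i)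
  have h4 := invFact_eq (a - i + 1)
  unfold symCoeff
  rw [show (2 * (i + 1 : ℕ) - (0 : ℕ) : ℤ) = 2 * i + 1 + 1 by push_cast; ring,
    show (2 * i - (0 : ℕ) : ℤ) = 2 * i by push_cast; ring,
    show ((a + 2 : ℕ) + 1 - (i + 1 : ℕ) + (0 : ℕ) : ℤ) = a - i + 1 + 1 by push_cast; ring,
    show ((a + 1 : ℕ) + 1 - i + (0 : ℕ) : ℤ) = a - i + 1 + 1 by push_cast; ring,
    show ((a + 1 : ℕ) + 1 - (i + 1 : ℕ) + (0 : ℕ) : ℤ) = a - i + 1 by push_cast; ring,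
    show (a + 1 - (i + 1 : ℕ) + (0 : ℕ) : ℤ) = a - i by push_cast; ring,
    h1, h2, h3, h4, show a + 2 + (i + 1) = a + i + 1 + 1 + 1 by ring,
    show a + 1 + (i + 1) = a + i + 1 + 1 by ring, show a + 1 + i = a + i + 1 by ring,
    show a + (i + 1) = a + i + 1 by ring]
  simp only [Nat.factorial_succ]
  push_cast
  ring

lemma antiCoeff_add_two (a i : ℕ) : antiCoeff (a + 2) 0 (i + 1) =
    antiCoeff (a + 1) 0 i + 2 * antiCoeff (a + 1) 0 (i + 1) - antiCoeff a 0 (i + 1) := by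
  have h1 := invFact_eq (2 * i + 1)
  have h2 := invFact_eq (2 * i + 1 + 1)
  have h3 := invFact_eq (a - i - 1)
  have h4 := invFact_eq (a - i)
  unfold antiCoeff
  rw [show (2 * (i + 1 : ℕ) + 1 - (0 : ℕ) : ℤ) = 2 * i + 1 + 1 + 1 by push_cast; ring,
    show (2 * i + 1 - (0 : ℕ) : ℤ) = 2 * i + 1 by push_cast; ring,
    show ((a + 2 : ℕ) - (i + 1 : ℕ) + (0 : ℕ) : ℤ) = a - i + 1 by push_cast; ring,
    show ((a + 1 : ℕ) - i + (0 : ℕ) : ℤ) = a - i + 1 by push_cast; ring,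
    show ((a + 1 : ℕ) - (i + 1 : ℕ) + (0 : ℕ) : ℤ) = a - i by push_cast; ring,
    show (a - (i + 1 : ℕ) + (0 : ℕ) : ℤ) = a - i - 1 by push_cast; ring,
    h1, h2, h3, sub_add_cancel, h4, show a + 2 + 1 + (i + 1) = a + i + 1 + 1 + 1 + 1 by ring,
    show a + 1 + 1 + (i + 1) = a + i + 1 + 1 + 1 by ring,
    show a + 1 + 1 + i = a + i + 1 + 1 by ring,
    show a + 1 + (i + 1) = a + i + 1 + 1 by ring]
  simp only [Nat.factorial_succ]
  push_cast
  ring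

lemma symCoeff_zero_zero (a : ℕ) : symCoeff a 0 0 = 2 := by
  have h1 := invFact_natCast 0
  have h2 := invFact_natCast (a + 1)
  have := a.factorial_ne_zero
  simp only [Nat.cast_zero, Nat.cast_add, Nat.cast_one] at h1 h2
  simp only [symCoeff, Nat.cast_zero, mul_zero, sub_zero, add_zero, h1, h2, Nat.factorial_succ]
  push_cast
  field_simp
  norm_num

lemma antiCoeff_zero_zero (a : ℕ) : antiCoeff a 0 0 = a + 1 := by
  have h1 := invFact_natCast 1
  have h2 := invFact_natCast a
  have := a.factorial_ne_zero
  simp only [Nat.cast_one] at h1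
  simp only [antiCoeff, Nat.cast_zero, mul_zero, sub_zero, add_zero, zero_add, h1, h2,
    Nat.factorial_succ]
  push_cast
  field_simp
  norm_num

lemma symCoeff_eq_zero {a i : ℕ} (h : a + 1 < i) : symCoeff a 0 i = 0 := by
  rw [symCoeff, invFact_of_neg (k := a + 1 - i + (0 : ℕ)) (by push_cast; omega), mul_zero]

lemma antiCoeff_eq_zero {a i : ℕ} (h : a < i) : antiCoeff a 0 i = 0 := by
  rw [antiCoeff, invFact_of_neg (k := a - i + (0 : ℕ)) (by push_cast; omega), mul_zero]

section Expansion

variable {R : Type*} [CommRing R] [Algebra ℚ R] {s t : R}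

lemma symmetrized_eq_sum (hst : s * t = 1) {a j K : ℕ} (hK : a + 1 + j < K) :
    s ^ (a + 1) * (s - 1) ^ j + t ^ (a + 1 + j) * (1 - s) ^ j =
      ∑ i ∈ range K, symCoeff a j i • (s + t - 2) ^ i := by
  have := eq_sum_smul_of_recurrence
    (fun a j => s ^ (a + 1) * (s - 1) ^ j + t ^ (a + 1 + j) * (1 - s) ^ j) symCoeff 1 (s + t - 2)
    ?_ ?_ ?_ symCoeff_add_two symCoeff_succ ?_ ?_ j a K hK
  · simpa using this
  · intro a
    linear_combination (-s ^ (a + 1) - t ^ (a + 1)) * hst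
  · intro a j
    linear_combination (-(t ^ (a + 1 + j) * (1 - s) ^ j)) * hst
  · intro a
    simp only [symCoeff_zero_zero]
    norm_num
  · intro K
    have h1 : symCoeff 0 0 1 = 1 := by norm_num [symCoeff, invFact, Nat.factorial, Int.toNat]
    rw [sum_range_succ', sum_range_succ', sum_eq_zero fun i _ => by
      rw [symCoeff_eq_zero (by omega), zero_smul]]
    simp only [zero_add, h1, symCoeff_zero_zero, two_smul, one_smul]
    ring
  · intro K
    have h1 : symCoeff 1 0 1 = 4 := by norm_num [symCoeff, invFact, Nat.factorial, Int.toNat]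
    have h2 : symCoeff 1 0 2 = 1 := by norm_num [symCoeff, invFact, Nat.factorial, Int.toNat]
    rw [sum_range_succ', sum_range_succ', sum_range_succ', sum_eq_zero fun i _ => by
      rw [symCoeff_eq_zero (by omega), zero_smul]]
    simp only [zero_add, Nat.reduceAdd, h1, h2, symCoeff_zero_zero, one_smul,
      show (4 : ℚ) = 2 + 2 by norm_num, add_smul, two_smul]
    linear_combination -2 * hst

lemma antisymmetrized_eq_sum (hst : s * t = 1) {a j K : ℕ} (hK : a + 1 + j < K) :
    s ^ (a + 1) * (s - 1) ^ j - t ^ (a + 1 + j) * (1 - s) ^ j =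
      ∑ i ∈ range K, antiCoeff a j i • ((s - t) * (s + t - 2) ^ i) := by
  refine eq_sum_smul_of_recurrence
    (fun a j => s ^ (a + 1) * (s - 1) ^ j - t ^ (a + 1 + j) * (1 - s) ^ j) antiCoeff (s - t)
    (s + t - 2) ?_ ?_ ?_ antiCoeff_add_two antiCoeff_succ ?_ ?_ j a K hK
  · intro a
    linear_combination (-s ^ (a + 1) + t ^ (a + 1)) * hst
  · intro a j
    linear_combination (t ^ (a + 1 + j) * (1 - s) ^ j) * hst
  · intro a
    simp only [antiCoeff_zero_zero]
    push_cast
    ring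
  · intro K
    rw [sum_range_succ', sum_eq_zero fun i _ => by
      rw [antiCoeff_eq_zero (by omega), zero_smul]]
    simp [antiCoeff_zero_zero]
  · intro K
    have h1 : antiCoeff 1 0 1 = 1 := by norm_num [antiCoeff, invFact, Nat.factorial, Int.toNat]
    rw [sum_range_succ', sum_range_succ', sum_eq_zero fun i _ => by
      rw [antiCoeff_eq_zero (by omega), zero_smul]]
    simp only [zero_add, h1, antiCoeff_zero_zero, one_smul, Nat.cast_one,
      show (1 + 1 : ℚ) = 2 by norm_num, two_smul]
    ring

end Expansion

lemma symCoeff_zero_right (x j : ℕ) : symCoeff (x + (j + 1)) (j + 1) 0 = 0 := by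
  rw [symCoeff, invFact_of_neg (k := 2 * (0 : ℕ) - (j + 1 : ℕ)) (by push_cast; omega)]
  ring

lemma symCoeff_succ_succ (x j i : ℕ) : symCoeff (x + (j + 1)) (j + 1) (i + 1) =
    (2 * x + 5 + 3 * j) * ent (x + 2) i j := by
  unfold symCoeff ent
  rw [show x + (j + 1) + (i + 1) = x + 2 + i + j by ring,
    show (2 * (i + 1 : ℕ) - (j + 1 : ℕ) : ℤ) = 2 * i + 1 - j by push_cast; ring,
    show ((x + (j + 1) : ℕ) + 1 - (i + 1 : ℕ) + (j + 1 : ℕ) : ℤ) = (x + 2 : ℕ) - i + 2 * j by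
      push_cast; ring]
  push_cast
  ring

lemma two_mul_antiCoeff_sub (x j i : ℕ) :
    2 * antiCoeff (x + j + 1) j i - antiCoeff (x + j) j i = (x + 3 + 3 * i) * ent (x + 1) i j := by
  have h := invFact_eq (x - i + 2 * j)
  unfold antiCoeff ent
  rw [show ((x + j + 1 : ℕ) - i + j : ℤ) = x - i + 2 * j + 1 by push_cast; ring,
    show ((x + j : ℕ) - i + j : ℤ) = x - i + 2 * j by push_cast; ring,
    show ((x + 1 : ℕ) - i + 2 * j : ℤ) = x - i + 2 * j + 1 by push_cast; ring, h,
    show x + j + 1 + 1 + i = x + 1 + i + j + 1 by ring, Nat.factorial_succ,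
    show x + j + 1 + i = x + 1 + i + j by ring]
  push_cast
  ring

section Reduction

variable {R : Type*} [CommRing R] {s t u : R}

lemma add_mul_pow_eq (hu : u = 1 - s) (hst : s * t = 1) (x j : ℕ) :
    (u ^ 2 - u) ^ j + t ^ (2 * x + 2) * (t ^ 2 - t) ^ j =
      t ^ (x + 1) * (s ^ (x + j + 1) * (s - 1) ^ j + t ^ (x + j + 1 + j) * (1 - s) ^ j) := by
  have e1 : u ^ 2 - u = s * (s - 1) := by rw [hu]; ring
  have e2 : t ^ 2 - t = t ^ 2 * (1 - s) := by linear_combination t * hst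
  have e3 : s ^ (x + 1) * t ^ (x + 1) = 1 := by rw [← mul_pow, hst, one_pow]
  rw [e1, e2, mul_pow, mul_pow]
  generalize (s - 1) ^ j = p
  generalize (1 - s) ^ j = q
  linear_combination (-(s ^ j * p)) * e3

lemma mul_add_mul_pow_eq (hu : u = 1 - s) (hst : s * t = 1) (x j : ℕ) :
    (u ^ 2 - u) ^ j * (1 - 2 * u) + t ^ (2 * x + 2) * ((t ^ 2 - t) ^ j * (1 - 2 * t)) =
      t ^ (x + 1) *
        (2 * (s ^ (x + j + 1 + 1) * (s - 1) ^ j - t ^ (x + j + 1 + 1 + j) * (1 - s) ^ j) -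
          (s ^ (x + j + 1) * (s - 1) ^ j - t ^ (x + j + 1 + j) * (1 - s) ^ j)) := by
  have e0 : 1 - 2 * u = 2 * s - 1 := by rw [hu]; ring
  have e1 : u ^ 2 - u = s * (s - 1) := by rw [hu]; ring
  have e2 : t ^ 2 - t = t ^ 2 * (1 - s) := by linear_combination t * hst
  have e3 : s ^ (x + 1) * t ^ (x + 1) = 1 := by rw [← mul_pow, hst, one_pow]
  rw [e0, e1, e2, mul_pow, mul_pow]
  generalize (s - 1) ^ j = p
  generalize (1 - s) ^ j = q
  linear_combination (-(s ^ j * p * (2 * s - 1))) * e3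

end Reduction

section PowerSeries

open PowerSeries

/-- The polynomials `(X² - X) ^ j` and `(X² - X) ^ j * (1 - 2X)`. -/
noncomputable def symPoly (j r : ℕ) : Polynomial ℚ :=
  (Polynomial.X ^ 2 - Polynomial.X) ^ j * (1 - 2 * Polynomial.X) ^ r

lemma natDegree_symPoly_le (j r : ℕ) : (symPoly j r).natDegree ≤ j * 2 + r * 1 := by
  refine Polynomial.natDegree_mul_le.trans (add_le_add ?_ ?_) <;>
    refine Polynomial.natDegree_pow_le.trans (Nat.mul_le_mul_left _ ?_) <;> compute_degree

lemma coeff_symPoly (j r : ℕ) : (symPoly j r).coeff (j * 2 + r * 1) = (-2) ^ r := by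
  have h1 : (Polynomial.X ^ 2 - Polynomial.X : Polynomial ℚ).natDegree ≤ 2 := by compute_degree
  have h2 : (1 - 2 * Polynomial.X : Polynomial ℚ).natDegree ≤ 1 := by compute_degree
  have h3 : (Polynomial.X ^ 2 - Polynomial.X : Polynomial ℚ).coeff 2 = 1 := by compute_degree!
  have h4 : (1 - 2 * Polynomial.X : Polynomial ℚ).coeff 1 = -2 := by compute_degree!
  rw [symPoly, Polynomial.coeff_mul_add_eq_of_natDegree_le
    (Polynomial.natDegree_pow_le.trans (Nat.mul_le_mul_left _ h1))
    (Polynomial.natDegree_pow_le.trans (Nat.mul_le_mul_left _ h2)),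
    Polynomial.coeff_pow_of_natDegree_le h1, Polynomial.coeff_pow_of_natDegree_le h2, h3, h4,
    one_pow, one_mul]

/-- The series `t ^ (x + 1) * (s - t) ^ r * (s + t - 2) ^ k` with `s = 1 - X`, `t = s⁻¹`. -/
noncomputable def symSeries (x r k : ℕ) : ℚ⟦X⟧ :=
  PowerSeries.mk 1 ^ (x + 1) * ((1 - X - PowerSeries.mk 1) ^ r * (1 - X + PowerSeries.mk 1 - 2) ^ k)

lemma symSeries_eq (x r k : ℕ) :
    symSeries x r k = X ^ (k * 2 + r) *
      (PowerSeries.mk 1 ^ (x + 1) * (-(1 + PowerSeries.mk 1)) ^ r * PowerSeries.mk 1 ^ k) := by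
  have h := mk_one_mul_one_sub_eq_one ℚ
  have e1 : (1 - X - PowerSeries.mk 1 : ℚ⟦X⟧) = X * -(1 + PowerSeries.mk 1) := by
    linear_combination -h
  have e2 : (1 - X + PowerSeries.mk 1 - 2 : ℚ⟦X⟧) = X ^ 2 * PowerSeries.mk 1 := by
    linear_combination (1 + X) * h
  rw [symSeries, e1, e2, mul_pow X]
  ring

lemma coeff_symSeries_of_lt {x r k i : ℕ} (h : i < k * 2 + r) :
    coeff i (symSeries x r k) = 0 := by
  rw [symSeries_eq, coeff_X_pow_mul', if_neg (by omega)]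

lemma coeff_symSeries_self (x r k : ℕ) : coeff (k * 2 + r) (symSeries x r k) = (-2) ^ r := by
  rw [symSeries_eq, coeff_X_pow_mul', if_pos le_rfl, Nat.sub_self, coeff_zero_eq_constantCoeff]
  have : constantCoeff (PowerSeries.mk 1 : ℚ⟦X⟧) = 1 := by
    rw [← coeff_zero_eq_constantCoeff_apply, coeff_mk]; rfl
  simp [this]
  norm_num

/-- Connection coefficients between `symPoly` and `symSeries`. -/
def symBlock (x r i j : ℕ) : ℚ :=
  if r = 0 then symCoeff (x + j) j i else 2 * antiCoeff (x + j + 1) j i - antiCoeff (x + j) j i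

lemma aeval_symPoly_add {x j r K : ℕ} (hr : r < 2) (hK : x + j + 2 + j < K) :
    Polynomial.aeval (X : ℚ⟦X⟧) (symPoly j r) +
        PowerSeries.mk 1 ^ (2 * x + 2) * Polynomial.aeval (PowerSeries.mk 1 : ℚ⟦X⟧) (symPoly j r) =
      ∑ k ∈ range K, symBlock x r k j • symSeries x r k := by
  have hst : (1 - X) * (PowerSeries.mk 1 : ℚ⟦X⟧) = 1 := by rw [mul_comm, mk_one_mul_one_sub_eq_one]
  have hu : (X : ℚ⟦X⟧) = 1 - (1 - X) := by ring
  simp only [symPoly, map_mul, map_pow, map_sub, map_one, map_ofNat, Polynomial.aeval_X]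
  interval_cases r
  · simp only [pow_zero, mul_one, add_mul_pow_eq hu hst, symSeries, symBlock, if_true, one_mul]
    rw [symmetrized_eq_sum hst (show x + j + 1 + j < K by omega), mul_sum]
    simp only [mul_smul_comm]
  · simp only [pow_one, mul_add_mul_pow_eq hu hst, symSeries, symBlock, one_ne_zero, if_false]
    rw [antisymmetrized_eq_sum hst (show x + j + 1 + j < K by omega),
      antisymmetrized_eq_sum hst (show x + j + 1 + 1 + j < K by omega), mul_sum,
      ← sum_sub_distrib, mul_sum]
    refine sum_congr rfl fun k _ => ?_
    rw [sub_smul, mul_smul, two_smul, two_mul]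
    simp only [mul_sub, mul_add, mul_smul_comm]

lemma coeff_mk_one_pow (m i : ℕ) :
    coeff i (PowerSeries.mk 1 ^ (m + 1) : ℚ⟦X⟧) = ((m + i).choose i : ℚ) := by
  rw [mk_one_pow_eq_mk_choose_add, coeff_mk, ← Nat.choose_symm_add]

lemma sum_choose_mul_coeff_symPoly {x j r N i : ℕ} (hN : j * 2 + r < N) :
    (symPoly j r).coeff i +
        ∑ k ∈ range N, ((2 * x + 1 + i + k).choose i : ℚ) * (symPoly j r).coeff k =
      coeff i (Polynomial.aeval (X : ℚ⟦X⟧) (symPoly j r) +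
        PowerSeries.mk 1 ^ (2 * x + 2) * Polynomial.aeval (PowerSeries.mk 1 : ℚ⟦X⟧) (symPoly j r)) := by
  have hd : (symPoly j r).natDegree < N := (natDegree_symPoly_le j r).trans_lt (by omega)
  rw [map_add, Polynomial.aeval_eq_sum_range' hd (PowerSeries.mk 1 : ℚ⟦X⟧), mul_sum, map_sum]
  congr 1
  · rw [← Polynomial.coeff_coe]
    rw [Polynomial.aeval_def, ← Polynomial.eval₂_C_X_eq_coe]
    rfl
  · refine sum_congr rfl fun k _ => ?_
    rw [mul_smul_comm, ← pow_add, coeff_smul, show 2 * x + 2 + k = 2 * x + 1 + k + 1 by ring,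
      coeff_mk_one_pow, mul_comm, smul_eq_mul, show 2 * x + 1 + i + k = 2 * x + 1 + k + i by ring]

lemma det_one_add_choose (n x : ℕ) :
    Matrix.det (Matrix.of fun i j : Fin (2 * n) =>
        (if i = j then (1 : ℚ) else 0) + ((2 * x + 1 + i + j).choose i : ℚ)) =
      Matrix.det (Matrix.of fun i j : Fin n => symBlock x 0 i j) *
        Matrix.det (Matrix.of fun i j : Fin n => symBlock x 1 i j) := by
  let e : Fin n × Fin 2 ≃ Fin (2 * n) := finProdFinEquiv.trans (finCongr (mul_comm n 2))
  have he : ∀ p, ((e p : Fin (2 * n)) : ℕ) = p.2 + 2 * p.1 := fun p => rfl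
  let U : Matrix (Fin (2 * n)) (Fin (2 * n)) ℚ :=
    Matrix.of fun i c => (symPoly (c / 2) (c % 2)).coeff i
  let K : Matrix (Fin (2 * n)) (Fin (2 * n)) ℚ :=
    Matrix.of fun i c => coeff i (symSeries x (c % 2) (c / 2))
  let M : Matrix (Fin (2 * n)) (Fin (2 * n)) ℚ := Matrix.of fun i c =>
    if (i : ℕ) % 2 = c % 2 then symBlock x (c % 2) (i / 2) (c / 2) else 0
  have hU : U.det = ∏ c : Fin (2 * n), (-2 : ℚ) ^ ((c : ℕ) % 2) := by
    rw [Matrix.det_of_isUpperTriangular fun i j hij => ?_]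
    · refine prod_congr rfl fun c _ => ?_
      have h := coeff_symPoly (c / 2) (c % 2)
      rwa [mul_one, Nat.div_add_mod'] at h
    · have hij : (j : ℕ) < i := hij
      exact Polynomial.coeff_eq_zero_of_natDegree_lt
        ((natDegree_symPoly_le (j / 2) (j % 2)).trans_lt (by omega))
  have hK : K.det = ∏ c : Fin (2 * n), (-2 : ℚ) ^ ((c : ℕ) % 2) := by
    rw [Matrix.det_of_isLowerTriangular _ fun i j hij => ?_]
    · refine prod_congr rfl fun c _ => ?_
      have h := coeff_symSeries_self x (c % 2) (c / 2)
      rwa [Nat.div_add_mod'] at h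
    · have hij : (i : ℕ) < j := hij
      exact coeff_symSeries_of_lt (by omega)
  have hM : M.det = Matrix.det (Matrix.of fun i j : Fin n => symBlock x 0 i j) *
      Matrix.det (Matrix.of fun i j : Fin n => symBlock x 1 i j) := by
    have hb : M.submatrix e e = Matrix.blockDiagonal fun r : Fin 2 =>
        Matrix.of fun i j : Fin n => symBlock x r i j := by
      ext ⟨i, r⟩ ⟨j, q⟩
      have hr := r.is_lt
      have hq := q.is_lt
      simp only [M, Matrix.submatrix_apply, Matrix.of_apply, he, Matrix.blockDiagonal_apply,
        Fin.ext_iff]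
      rw [show ((r : ℕ) + 2 * i) % 2 = r by omega, show ((q : ℕ) + 2 * j) % 2 = q by omega,
        show ((r : ℕ) + 2 * i) / 2 = i by omega, show ((q : ℕ) + 2 * j) / 2 = j by omega]
      split_ifs with h
      · rw [h]
      · rfl
    rw [← Matrix.det_submatrix_equiv_self e, hb, Matrix.det_blockDiagonal, Fin.prod_univ_two]
    rfl
  have hmul : (Matrix.of fun i j : Fin (2 * n) =>
      (if i = j then (1 : ℚ) else 0) + ((2 * x + 1 + i + j).choose i : ℚ)) * U = K * M := by
    ext i c
    have hc := c.is_lt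
    have hr : (c : ℕ) % 2 < 2 := Nat.mod_lt _ two_pos
    simp only [Matrix.mul_apply, U, K, M, Matrix.of_apply, add_mul, ite_mul, one_mul, zero_mul,
      sum_add_distrib, sum_ite_eq, mem_univ, if_true]
    rw [← sum_range fun k =>
        ((2 * x + 1 + i + k).choose i : ℚ) * (symPoly (c / 2) (c % 2)).coeff k,
      sum_choose_mul_coeff_symPoly (by omega),
      aeval_symPoly_add hr (show _ < n + (x + c / 2 + 2 + c / 2) + 1 by omega),
      map_sum, ← e.sum_comp, Fintype.sum_prod_type, add_assoc, sum_range_add,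
      sum_eq_zero (s := range (x + c / 2 + 2 + c / 2 + 1)) fun k _ => by
        rw [coeff_smul, coeff_symSeries_of_lt (by omega), smul_zero], add_zero, sum_range]
    refine sum_congr rfl fun k _ => ?_
    rw [sum_eq_single (⟨c % 2, hr⟩ : Fin 2)]
    · simp only [he]
      rw [if_pos (by omega), show (c % 2 + 2 * (k : ℕ)) % 2 = c % 2 by omega,
        show (c % 2 + 2 * (k : ℕ)) / 2 = k by omega, coeff_smul, smul_eq_mul, mul_comm]
    · intro r _ h
      have hr := r.is_lt
      have h : (r : ℕ) ≠ c % 2 := fun h' => h (Fin.ext h')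
      rw [he, if_neg (show ¬ ((r : ℕ) + 2 * k) % 2 = c % 2 by omega), mul_zero]
    · simp
  have h := congrArg Matrix.det hmul
  rw [Matrix.det_mul, Matrix.det_mul, hU, hK, hM, mul_comm] at h
  refine mul_left_cancel₀ (prod_ne_zero_iff.mpr fun c _ => ?_) h
  exact pow_ne_zero _ (by norm_num)

end PowerSeries

lemma det_symBlock_zero (n x : ℕ) :
    Matrix.det (Matrix.of fun i j : Fin (n + 1) => symBlock x 0 i j) =
      2 * ∏ m ∈ range n, (2 * x + 5 + 3 * m) * pivot (x + 2) m := by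
  rw [Matrix.det_succ_row_zero, Fin.sum_univ_succ, sum_eq_zero fun j _ => by
    simp [symBlock, symCoeff_zero_right], prod_mul_distrib, ← det_ent (by omega),
    ← Fin.prod_univ_eq_prod_range fun m => (2 * x + 5 + 3 * m : ℚ), ← Matrix.det_mul_row]
  simp only [symBlock, Matrix.of_apply, if_true, Fin.val_zero, symCoeff_zero_zero, pow_zero,
    one_mul, add_zero]
  congr 2
  ext i j
  simp [symCoeff_succ_succ]

lemma det_symBlock_one (n x : ℕ) :
    Matrix.det (Matrix.of fun i j : Fin n => symBlock x 1 i j) =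
      ∏ m ∈ range n, (x + 3 + 3 * m) * pivot (x + 1) m := by
  rw [prod_mul_distrib, ← det_ent (by omega),
    ← Fin.prod_univ_eq_prod_range fun m => (x + 3 + 3 * m : ℚ), ← Matrix.det_mul_column]
  congr 1
  ext i j
  simp [symBlock, two_mul_antiCoeff_sub]

lemma asc_succ_mul_factorial (a k : ℕ) : asc (a + 1) k * a.factorial = (a + k).factorial := by
  induction k with
  | zero => simp [asc]
  | succ k ih =>
    rw [asc, prod_range_succ, ← asc, mul_right_comm, ih, ← add_assoc, Nat.factorial_succ]
    push_cast
    ring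

lemma asc_succ (a k : ℕ) : asc (a + 1) k = (a + k).factorial / a.factorial := by
  rw [← asc_succ_mul_factorial, mul_div_cancel_right₀ _ (by exact_mod_cast a.factorial_ne_zero)]

/-- Ratio of consecutive values of the number of cyclically symmetric lozenge tilings. -/
def ratio (x n : ℕ) : ℚ :=
  (x + 3 * n + 3).factorial * (x + 3 * n).factorial * ((x + n).factorial * n.factorial *
    (2 * x + 3 * n + 2).factorial) ^ 2 / (2 * (2 * n + 1) * (x + 2 * n + 2).factorial *
    (x + 2 * n).factorial * ((x + 2 * n + 1).factorial * (2 * x + 2 * n + 1).factorial *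
    (2 * n).factorial) ^ 2)

lemma ratio_succ (x n : ℕ) : ratio x (n + 1) = ratio x n *
    ((x + 3 * n + 4) * (x + 3 * n + 5) * (x + 3 * n + 6) * (x + 3 * n + 1) * (x + 3 * n + 2) *
      (x + 3 * n + 3) * ((2 * x + 3 * n + 3) * (2 * x + 3 * n + 4) * (2 * x + 3 * n + 5)) ^ 2 /
      (16 * (2 * n + 1) * (2 * n + 3) * (x + 2 * n + 1) * (x + 2 * n + 2) ^ 3 *
        (x + 2 * n + 3) ^ 3 * (x + 2 * n + 4) * (2 * x + 2 * n + 3) ^ 2)) := by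
  unfold ratio
  rw [show x + 3 * (n + 1) + 3 = x + 3 * n + 3 + 1 + 1 + 1 by ring,
    show x + 3 * (n + 1) = x + 3 * n + 1 + 1 + 1 by ring, ← add_assoc x n 1,
    show 2 * x + 3 * (n + 1) + 2 = 2 * x + 3 * n + 2 + 1 + 1 + 1 by ring,
    show x + 2 * (n + 1) + 2 = x + 2 * n + 2 + 1 + 1 by ring,
    show x + 2 * (n + 1) + 1 = x + 2 * n + 1 + 1 + 1 by ring,
    show x + 2 * (n + 1) = x + 2 * n + 1 + 1 by ring,
    show 2 * x + 2 * (n + 1) + 1 = 2 * x + 2 * n + 1 + 1 + 1 by ring,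
    show 2 * (n + 1) = 2 * n + 1 + 1 by ring]
  have h1 := (x + 2 * n).factorial_ne_zero
  have h2 := (2 * x + 2 * n + 1).factorial_ne_zero
  have h3 := (2 * n).factorial_ne_zero
  simp only [Nat.factorial_succ]
  push_cast
  field_simp
  ring

lemma pivot_mul_pivot_eq_ratio (x n : ℕ) :
    (2 * x + 5 + 3 * n) * pivot (x + 2) n * ((x + 3 + 3 * (n + 1)) * pivot (x + 1) (n + 1)) =
      ratio x (n + 1) := by
  induction n with
  | zero =>
    simp only [pivot, ratio, zero_add, prod_range_one, prod_range_zero, mul_one, Nat.reduceAdd,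
      add_assoc]
    simp only [← add_assoc, Nat.factorial]
    push_cast
    field_simp
    ring
  | succ n ih =>
    rw [ratio_succ, ← ih]
    simp only [pivot, prod_range_succ]
    push_cast
    field_simp
    ring

/-- The right-hand side of the product formula. -/
def tilingCount (x n : ℕ) : ℚ :=
  ((n.factorial : ℚ) * ((x - 1).factorial : ℚ) / ((2 * n).factorial : ℚ)) *
    (∏ i ∈ Finset.range (n + 1),
      asc (x + 2 * i) (i + 1) / ((x + n + i).factorial : ℚ)) *
    ∏ i ∈ Finset.range n,
      ((i.factorial : ℚ) ^ 2 * (asc (2 * x + 2 * i + 2) (i + 1)) ^ 2 *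
          ((x + i).factorial : ℚ) * asc (x + 2 * i + 1) i) /
        ((2 * i).factorial : ℚ) ^ 2

lemma tilingCount_succ (x n : ℕ) : tilingCount x (n + 1) = tilingCount x n * ratio x n := by
  have hf : ∏ i ∈ range (n + 1 + 1), ((x + (n + 1) + i).factorial : ℚ) =
      (∏ i ∈ range (n + 1), ((x + n + i).factorial : ℚ)) *
        ((x + 2 * n + 1).factorial * (x + 2 * n + 2).factorial / (x + n).factorial) := by
    have h0 := (x + n).factorial_ne_zero
    rw [prod_range_succ, prod_range_succ, prod_range_succ']
    simp only [add_zero, show ∀ i, x + (n + 1) + i = x + n + (i + 1) by intro i; ring]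
    rw [show x + n + (n + 1) = x + 2 * n + 1 by ring,
      show x + n + (n + 1 + 1) = x + 2 * n + 2 by ring]
    field_simp
  have hp : ∏ i ∈ range (n + 1), ((x + n + i).factorial : ℚ) ≠ 0 :=
    prod_ne_zero_iff.mpr fun i _ => by exact_mod_cast (x + n + i).factorial_ne_zero
  unfold tilingCount ratio
  have hd := fun (m k : ℕ) => prod_div_distrib (s := range k)
    (f := fun i => asc (x + 2 * i) (i + 1)) (g := fun i => ((x + m + i).factorial : ℚ))
  rw [hd, hd, hf, prod_range_succ _ (n + 1),
    prod_range_succ (fun i => ((i.factorial : ℚ) ^ 2 * (asc (2 * x + 2 * i + 2) (i + 1)) ^ 2 *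
      ((x + i).factorial : ℚ) * asc (x + 2 * i + 1) i) / ((2 * i).factorial : ℚ) ^ 2),
    show x + 2 * (n + 1) = x + 2 * n + 1 + 1 by ring, asc_succ, asc_succ, asc_succ,
    show x + 2 * n + 1 + (n + 1 + 1) = x + 3 * n + 3 by ring,
    show 2 * x + 2 * n + 1 + (n + 1) = 2 * x + 3 * n + 2 by ring,
    show x + 2 * n + n = x + 3 * n by ring, show 2 * (n + 1) = 2 * n + 1 + 1 by ring]
  generalize ∏ i ∈ range (n + 1), ((x + n + i).factorial : ℚ) = p at hp ⊢
  generalize ∏ i ∈ range (n + 1), asc (x + 2 * i) (i + 1) = q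
  generalize (∏ i ∈ range n, _ : ℚ) = r
  have h1 := (x + 2 * n).factorial_ne_zero
  have h2 := (2 * x + 2 * n + 1).factorial_ne_zero
  have h3 := (2 * n).factorial_ne_zero
  have h4 := (x + n).factorial_ne_zero
  simp only [Nat.factorial_succ]
  push_cast
  field_simp
  ring

lemma tilingCount_one {x : ℕ} (hx : 0 < x) : tilingCount x 1 = 2 * (x + 3) := by
  obtain ⟨x, rfl⟩ := Nat.exists_eq_add_of_le' hx
  have := x.factorial_ne_zero
  simp only [tilingCount, prod_range_succ, prod_range_zero, asc,
    show x + 1 + 1 + 1 = x + 2 + 1 by ring, Nat.add_sub_cancel, add_zero, mul_zero, mul_one,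
    one_mul, Nat.factorial]
  push_cast
  field_simp
  ring

lemma det_one_add_choose_eq_tilingCount {x : ℕ} (hx : 0 < x) (n : ℕ) :
    Matrix.det (Matrix.of fun i j : Fin (2 * (n + 1)) =>
        (if i = j then (1 : ℚ) else 0) + ((2 * x + 1 + i + j).choose i : ℚ)) =
      tilingCount x (n + 1) := by
  rw [det_one_add_choose, det_symBlock_zero, det_symBlock_one]
  induction n with
  | zero =>
    rw [tilingCount_one hx]
    simp [pivot]
  | succ n ih =>
    rw [tilingCount_succ, ← ih, ← pivot_mul_pivot_eq_ratio, prod_range_succ _ n,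
      prod_range_succ _ (n + 1)]
    push_cast
    ring

theorem CS_even (n x : ℕ) (hn : 0 < n) (hx : 0 < x) :
    Matrix.det (fun i j : Fin (2 * n) =>
        (if i = j then (1 : ℚ) else 0) + C (2 * x + 1 + (i : ℕ) + (j : ℕ)) (i : ℤ)) =
      ((n.factorial : ℚ) * ((x - 1).factorial : ℚ) / ((2 * n).factorial : ℚ)) *
        (∏ i ∈ Finset.range (n + 1),
          asc (x + 2 * i) (i + 1) / ((x + n + i).factorial : ℚ)) *
        ∏ i ∈ Finset.range n,
          ((i.factorial : ℚ) ^ 2 * (asc (2 * x + 2 * i + 2) (i + 1)) ^ 2 *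
              ((x + i).factorial : ℚ) * asc (x + 2 * i + 1) i) /
            ((2 * i).factorial : ℚ) ^ 2 := by
  obtain ⟨n, rfl⟩ := Nat.exists_eq_add_of_le' hn
  exact det_one_add_choose_eq_tilingCount hx n
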